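/- Let G be a (P₂ ∪ P₄, HVN)-free graph with ω(G) = ω ≥ 4, let A be an induced complete ω-partite subgraph of G of maximum order with parts A₁,…,A_ω, let H be the subgraph of G induced on V(G) ∖ V(A) with k = ω(H) ≥ 4, and let B be an induced complete k-partite subgraph of H of maximum order with parts B₁,…,B_k. Assume that every vertex of V(A) has all its neighbours in V(B) inside at most one part of B. Suppose there exist adjacent vertices x, y ∈ V(G) ∖ (V(A) ∪ V(B)) such that both x and y have all their A-neighbours in Aᵢ and all their B-neighbours in B_p, with these neighbour sets nonempty. Then every vertex of V(A) ∖ Aᵢ is nonadjacent to every vertex of V(B) ∖ B_p. -/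

import Mathlib

open SimpleGraph

/-- `P₂ ∪ P₄`: the disjoint union of a path on 2 vertices (vertices 0,1) and a
path on 4 vertices (vertices 2,3,4,5). -/
def P2P4 : SimpleGraph (Fin 6) :=
  SimpleGraph.fromEdgeSet {s(0, 1), s(2, 3), s(3, 4), s(4, 5)}

/-- The HVN: `K₅` minus two edges incident to a common vertex; `{0,1,2,3}` is a
clique and vertex `4` is adjacent exactly to `0` and `1`. -/
def HVN : SimpleGraph (Fin 5) :=
  SimpleGraph.fromEdgeSet
    {s(0, 1), s(0, 2), s(0, 3), s(1, 2), s(1, 3), s(2, 3), s(4, 0), s(4, 1)}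

/-- A graph `G` is `H`-free if it has no induced subgraph isomorphic to `H`,
i.e. there is no graph embedding of `H` into `G`. -/
def IsFree {W V : Type*} (G : SimpleGraph V) (H : SimpleGraph W) : Prop :=
  IsEmpty (H ↪g G)

/-- `A` is an induced complete `m`-partite subgraph of `G` all of whose parts lie in `W`:
the parts are nonempty, pairwise disjoint, stable sets, and any two vertices in
different parts are adjacent. -/
def IsCompMultipartite {V : Type*} (G : SimpleGraph V) (W : Set V) {m : ℕ}
    (A : Fin m → Finset V) : Prop :=
  (∀ i, (A i).Nonempty) ∧
  (∀ i, ↑(A i) ⊆ W) ∧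
  (∀ i j, i ≠ j → Disjoint (A i) (A j)) ∧
  (∀ i, ∀ x ∈ A i, ∀ y ∈ A i, ¬ G.Adj x y) ∧
  (∀ i j, i ≠ j → ∀ x ∈ A i, ∀ y ∈ A j, G.Adj x y)

/-- `A` is an induced complete `m`-partite subgraph of `G` (with parts inside `W`)
of maximum order. -/
def IsMaxCompMultipartite {V : Type*} (G : SimpleGraph V) (W : Set V) {m : ℕ}
    (A : Fin m → Finset V) : Prop :=
  IsCompMultipartite G W A ∧
    ∀ B : Fin m → Finset V, IsCompMultipartite G W B →
      ∑ i, (B i).card ≤ ∑ i, (A i).card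

/-- A map that preserves and reflects adjacency out of a graph in which distinct vertices have
distinct neighbourhoods is injective, hence an embedding. -/
theorem not_isFree_of_adj_iff {V W : Type*} {G : SimpleGraph V} {H : SimpleGraph W}
    (hH : ∀ i j, (∀ l, H.Adj i l ↔ H.Adj j l) → i = j) (f : W → V)
    (hf : ∀ i j, G.Adj (f i) (f j) ↔ H.Adj i j) : ¬ IsFree G H := by
  intro h
  refine h.false ⟨⟨f, fun i j hij => hH i j fun l => ?_⟩, hf _ _⟩
  rw [← hf, ← hf, hij]

theorem IsFree.not_P2P4 {V : Type*} {G : SimpleGraph V} (h : IsFree G P2P4)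
    {x y a b c d : V} (hxy : G.Adj x y) (hab : G.Adj a b) (hbc : G.Adj b c) (hcd : G.Adj c d)
    (hac : ¬ G.Adj a c) (had : ¬ G.Adj a d) (hbd : ¬ G.Adj b d)
    (hxa : ¬ G.Adj x a) (hxb : ¬ G.Adj x b) (hxc : ¬ G.Adj x c) (hxd : ¬ G.Adj x d)
    (hya : ¬ G.Adj y a) (hyb : ¬ G.Adj y b) (hyc : ¬ G.Adj y c) (hyd : ¬ G.Adj y d) : False := by
  refine not_isFree_of_adj_iff ?_ ![x, y, a, b, c, d] ?_ h
  · simp only [P2P4, fromEdgeSet_adj, Set.mem_insert_iff, Set.mem_singleton_iff]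
    decide
  · intro i j
    fin_cases i <;> fin_cases j <;>
      simp [P2P4, G.adj_comm, *]

theorem IsFree.not_HVN {V : Type*} {G : SimpleGraph V} (h : IsFree G HVN)
    {a b c d v : V} (hab : G.Adj a b) (hac : G.Adj a c) (had : G.Adj a d) (hbc : G.Adj b c)
    (hbd : G.Adj b d) (hcd : G.Adj c d) (hva : G.Adj v a) (hvb : G.Adj v b)
    (hvc : ¬ G.Adj v c) (hvd : ¬ G.Adj v d) : False := by
  refine not_isFree_of_adj_iff ?_ ![a, b, c, d, v] ?_ h
  · simp only [HVN, fromEdgeSet_adj, Set.mem_insert_iff, Set.mem_singleton_iff]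
    decide
  · have := hab.symm
    have := hac.symm
    have := had.symm
    have := hbc.symm
    have := hbd.symm
    have := hcd.symm
    have := hva.symm
    have := hvb.symm
    have := mt G.adj_symm hvc
    have := mt G.adj_symm hvd
    intro i j
    fin_cases i <;> fin_cases j <;> simp [HVN, *]

theorem Fin.exists_ne_ne_ne {w : ℕ} (hw : 4 ≤ w) (a b c : Fin w) :
    ∃ d, d ≠ a ∧ d ≠ b ∧ d ≠ c := by
  have h : ({a, b, c} : Finset (Fin w)).card < (Finset.univ : Finset (Fin w)).card := by
    have := Finset.card_le_three (a := a) (b := b) (c := c)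
    rw [Finset.card_univ, Fintype.card_fin]
    omega
  obtain ⟨d, -, hd⟩ := Finset.exists_mem_notMem_of_card_lt_card h
  exact ⟨d, by simpa using hd⟩

/-- A vertex outside a complete `ω(G)`-partite subgraph of maximum order has nonneighbours in
parts other than any given one. -/
theorem IsMaxCompMultipartite.exists_ne_nonadj {V : Type*} [Fintype V] {G : SimpleGraph V}
    {A : Fin G.cliqueNum → Finset V} (hA : IsMaxCompMultipartite G Set.univ A)
    {v : V} (hv : ∀ s, v ∉ A s) (z : Fin G.cliqueNum) :
    ∃ s, s ≠ z ∧ ∃ u ∈ A s, ¬ G.Adj v u := by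
  classical
  obtain ⟨⟨hne, -, hdisj, hstab, hadj⟩, hmax⟩ := hA
  by_contra! hQ
  by_cases hz : ∃ c ∈ A z, G.Adj v c
  · have hall : ∀ s, ∃ c, c ∈ A s ∧ G.Adj v c := fun s => by
      rcases eq_or_ne s z with rfl | hs
      · exact hz
      · exact (hne s).imp fun c hc => ⟨hc, hQ s hs c hc⟩
    choose f hfA hfv using hall
    have hinj : Function.Injective f := fun s t hst => by
      by_contra hne'
      exact G.irrefl (hst ▸ hadj s t hne' _ (hfA s) _ (hfA t))
    have hcl : G.IsClique ↑(insert v (Finset.univ.image f)) := by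
      rw [Finset.coe_insert]
      refine IsClique.insert ?_ ?_
      · rintro _ hs _ ht hst
        simp only [Finset.coe_image, Finset.coe_univ, Set.image_univ, Set.mem_range] at hs ht
        obtain ⟨s, rfl⟩ := hs
        obtain ⟨t, rfl⟩ := ht
        exact hadj s t (fun h => hst (h ▸ rfl)) _ (hfA s) _ (hfA t)
      · simpa using fun s _ => hfv s
    have hcard := hcl.card_le_cliqueNum
    rw [Finset.card_insert_of_notMem, Finset.card_image_of_injective _ hinj, Finset.card_univ,
      Fintype.card_fin] at hcard
    · omega
    · simp only [Finset.mem_image, Finset.mem_univ, true_and, not_exists]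
      rintro s rfl
      exact hv s (hfA s)
  · push Not at hz
    have hmem : ∀ s u, u ∈ Function.update A z (insert v (A z)) s ↔
        u ∈ A s ∨ (s = z ∧ u = v) := fun s u => by
      rcases eq_or_ne s z with rfl | hs
      · simp [or_comm]
      · simp [hs]
    have hlt : ∑ s, (A s).card < ∑ s, (Function.update A z (insert v (A z)) s).card := by
      refine Finset.sum_lt_sum (fun s _ => Finset.card_le_card fun u hu => ?_)
        ⟨z, Finset.mem_univ _, ?_⟩
      · exact (hmem s u).2 (Or.inl hu)
      · simp [hv z]
    refine hlt.not_ge (hmax _ ⟨fun s => (hne s).imp fun u hu => (hmem s u).2 (Or.inl hu),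
      fun _ => Set.subset_univ _, fun s t hst => ?_, fun s u hu u' hu' => ?_,
      fun s t hst u hu u' hu' => ?_⟩)
    · rw [Finset.disjoint_left]
      intro u hu hu'
      have : u ∈ A s → u ∉ A t := fun h => Finset.disjoint_left.1 (hdisj s t hst) h
      rw [hmem] at hu hu'
      grind
    · rw [hmem] at hu hu'
      have := G.adj_comm u v
      have := G.irrefl (v := v)
      grind
    · rw [hmem] at hu hu'
      have := G.adj_comm u v
      grind

/-- In an HVN-free graph, a vertex outside a complete `ω(G)`-partite subgraph of maximum order
has all its neighbours in that subgraph inside one part. -/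
theorem IsMaxCompMultipartite.eq_of_adj {V : Type*} [Fintype V] {G : SimpleGraph V}
    (hG : IsFree G HVN) (hw : 4 ≤ G.cliqueNum) {A : Fin G.cliqueNum → Finset V}
    (hA : IsMaxCompMultipartite G Set.univ A) {v : V} (hv : ∀ s, v ∉ A s)
    {j l : Fin G.cliqueNum} (hj : ∃ a ∈ A j, G.Adj v a) (hl : ∃ a ∈ A l, G.Adj v a) : j = l := by
  have hforb : ∀ r z s t, r ≠ z → r ≠ s → r ≠ t → z ≠ s → z ≠ t → s ≠ t →
      (∃ c ∈ A r, G.Adj v c) → (∃ c ∈ A z, G.Adj v c) →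
      (∃ c ∈ A s, ¬ G.Adj v c) → (∃ c ∈ A t, ¬ G.Adj v c) → False := by
    rintro r z s t h₁ h₂ h₃ h₄ h₅ h₆ ⟨a, ha, hva⟩ ⟨b, hb, hvb⟩ ⟨c, hc, hvc⟩ ⟨d, hd, hvd⟩
    have hadj := hA.1.2.2.2.2
    exact hG.not_HVN (hadj _ _ h₁ _ ha _ hb) (hadj _ _ h₂ _ ha _ hc) (hadj _ _ h₃ _ ha _ hd)
      (hadj _ _ h₄ _ hb _ hc) (hadj _ _ h₅ _ hb _ hd) (hadj _ _ h₆ _ hc _ hd) hva hvb hvc hvd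
  have hor : ∀ s, (∃ c ∈ A s, G.Adj v c) ∨ (∃ c ∈ A s, ¬ G.Adj v c) := fun s => by
    obtain ⟨c, hc⟩ := hA.1.1 s
    by_cases h : G.Adj v c
    exacts [Or.inl ⟨c, hc, h⟩, Or.inr ⟨c, hc, h⟩]
  obtain ⟨s, -, hs⟩ := hA.exists_ne_nonadj hv j
  obtain ⟨t, hts, ht⟩ := hA.exists_ne_nonadj hv s
  by_contra hjl
  obtain ⟨m, hm⟩ := Fin.exists_ne_ne_ne hw j l j
  obtain ⟨n, hn⟩ := Fin.exists_ne_ne_ne hw j l m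
  generalize hP : (fun s => ∃ c ∈ A s, G.Adj v c) = P at *
  generalize hQ : (fun s => ∃ c ∈ A s, ¬ G.Adj v c) = Q at *
  have eP : ∀ s, (∃ c ∈ A s, G.Adj v c) = P s := fun s => by rw [← hP]
  have eQ : ∀ s, (∃ c ∈ A s, ¬ G.Adj v c) = Q s := fun s => by rw [← hQ]
  simp only [eP, eQ] at *
  have key : ∀ m n, m ≠ j → m ≠ l → n ≠ j → n ≠ l → n ≠ m → ¬ Q m → False := by
    intro m n hmj hml hnj hnl hnm hQm
    have hPm : P m := (hor m).resolve_right hQm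
    have hjst : j = s ∨ j = t := by
      by_contra h
      exact hforb j m s t (by grind) (by grind) (by grind) (by grind) (by grind) (by grind)
        hj hPm hs ht
    have hlst : l = s ∨ l = t := by
      by_contra h
      exact hforb l m s t (by grind) (by grind) (by grind) (by grind) (by grind) (by grind)
        hl hPm hs ht
    have hQj : Q j := by grind
    rcases hor n with hPn | hQn
    · exact hforb n m s t (by grind) (by grind) (by grind) (by grind) (by grind) (by grind)
        hPn hPm hs ht
    · exact hforb l m j n (by grind) (by grind) (by grind) (by grind) (by grind) (by grind)
        hl hPm hQj hQn
  refine key m n hm.1 hm.2.1 hn.1 hn.2.1 hn.2.2 fun hQm => ?_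
  refine key n m hn.1 hn.2.1 hm.1 hm.2.1 hn.2.2.symm fun hQn => ?_
  exact hforb j l m n hjl hm.1.symm hn.1.symm hm.2.1.symm hn.2.1.symm hn.2.2.symm hj hl hQm hQn

/-- Property (P5).  Let `G` be `(P₂ ∪ P₄, HVN)`-free with `ω(G) = ω ≥ 4`, `A` an
induced complete `ω`-partite subgraph of maximum order, `H` the subgraph induced
on `V(G) ∖ V(A)` with `k = ω(H) ≥ 4`, and `B` an induced complete `k`-partite
subgraph of `H` of maximum order; assume every vertex of `V(A)` has its
`B`-neighbours inside at most one part of `B`.  If there are adjacent vertices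
`x, y ∈ V(G) ∖ (V(A) ∪ V(B))` both having all their `A`-neighbours in `Aᵢ` and
all their `B`-neighbours in `B_p` (with these neighbour sets nonempty), then
every vertex of `V(A) ∖ Aᵢ` is nonadjacent to every vertex of `V(B) ∖ B_p`. -/
theorem anticomplete_P5 {V : Type*} [Fintype V] (G : SimpleGraph V)
    (h1 : IsFree G P2P4) (h2 : IsFree G HVN)
    (w : ℕ) (hw : 4 ≤ w) (hGw : G.cliqueNum = w)
    (A : Fin w → Finset V) (hA : IsMaxCompMultipartite G Set.univ A)
    (k : ℕ) (hk4 : 4 ≤ k)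
    (hk : (G.induce (⋃ i, (↑(A i) : Set V))ᶜ).cliqueNum = k)
    (B : Fin k → Finset V)
    (hB : IsMaxCompMultipartite G (⋃ i, (↑(A i) : Set V))ᶜ B)
    (hAB : ∀ v ∈ ⋃ i, (↑(A i) : Set V), ∀ p q : Fin k,
      (∃ b ∈ B p, G.Adj v b) → (∃ b ∈ B q, G.Adj v b) → p = q)
    (x y : V)
    (hx : x ∉ (⋃ i, (↑(A i) : Set V)) ∪ ⋃ j, (↑(B j) : Set V))
    (hy : y ∉ (⋃ i, (↑(A i) : Set V)) ∪ ⋃ j, (↑(B j) : Set V))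
    (hxy : G.Adj x y) (i : Fin w) (p : Fin k)
    (hxA : (∃ a ∈ A i, G.Adj x a) ∧
      ∀ a ∈ ⋃ t, (↑(A t) : Set V), G.Adj x a → a ∈ A i)
    (hxB : (∃ b ∈ B p, G.Adj x b) ∧
      ∀ b ∈ ⋃ t, (↑(B t) : Set V), G.Adj x b → b ∈ B p)
    (hyA : (∃ a ∈ A i, G.Adj y a) ∧
      ∀ a ∈ ⋃ t, (↑(A t) : Set V), G.Adj y a → a ∈ A i)
    (hyB : (∃ b ∈ B p, G.Adj y b) ∧
      ∀ b ∈ ⋃ t, (↑(B t) : Set V), G.Adj y b → b ∈ B p) :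
    ∀ a ∈ ⋃ t, (↑(A t) : Set V), a ∉ A i →
      ∀ b ∈ ⋃ t, (↑(B t) : Set V), b ∉ B p → ¬ G.Adj a b := by
  subst hGw
  intro a ha haAi b hb hbBp hab
  have hBA : ∀ r, ∀ c ∈ B r, ∀ s, c ∉ A s := fun r c hc s hs =>
    hB.1.2.1 r hc (Set.mem_iUnion.2 ⟨s, hs⟩)
  have hAadj := hA.1.2.2.2.2
  have hBadj := hB.1.2.2.2.2
  obtain ⟨j, haj⟩ := Set.mem_iUnion.1 ha
  obtain ⟨q, hbq⟩ := Set.mem_iUnion.1 hb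
  have hdA : ∀ s, s ≠ i → ∀ c ∈ A s, c ∉ A i := fun s hs c hc =>
    Finset.disjoint_left.1 (hA.1.2.2.1 s i hs) hc
  have hdB : ∀ s, s ≠ p → ∀ c ∈ B s, c ∉ B p := fun s hs c hc =>
    Finset.disjoint_left.1 (hB.1.2.2.1 s p hs) hc
  obtain ⟨r, hrp, hrq, -⟩ := Fin.exists_ne_ne_ne hk4 p q q
  obtain ⟨b', hb'⟩ := hB.1.1 r
  have hb'B : b' ∈ ⋃ t, (↑(B t) : Set V) := Set.mem_iUnion.2 ⟨r, hb'⟩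
  obtain ⟨l, hli, hlj, hlb'⟩ : ∃ l, l ≠ i ∧ l ≠ j ∧ ∀ c ∈ A l, ¬ G.Adj b' c := by
    obtain ⟨m, hmi, hmj, -⟩ := Fin.exists_ne_ne_ne hw i j j
    obtain ⟨n, hni, hnj, hnm⟩ := Fin.exists_ne_ne_ne hw i j m
    by_contra! h
    exact hnm (hA.eq_of_adj h2 hw (hBA r b' hb') (h n hni hnj) (h m hmi hmj))
  obtain ⟨a', ha'⟩ := hA.1.1 l
  have ha'A : a' ∈ ⋃ t, (↑(A t) : Set V) := Set.mem_iUnion.2 ⟨l, ha'⟩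
  refine h1.not_P2P4 hxy (hAadj l j hlj a' ha' a haj) hab (hBadj q r hrq.symm b hbq b' hb')
    (fun h => hlj (hA.eq_of_adj h2 hw (hBA q b hbq) ⟨a', ha', h.symm⟩ ⟨a, haj, hab.symm⟩))
    (fun h => hlb' a' ha' h.symm) (fun h => hrq (hAB a ha r q ⟨b', hb', h⟩ ⟨b, hbq, hab⟩))
    (fun h => hdA l hli a' ha' (hxA.2 a' ha'A h)) (fun h => haAi (hxA.2 a ha h))
    (fun h => hbBp (hxB.2 b hb h)) (fun h => hdB r hrp b' hb' (hxB.2 b' hb'B h))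
    (fun h => hdA l hli a' ha' (hyA.2 a' ha'A h)) (fun h => haAi (hyA.2 a ha h))
    (fun h => hbBp (hyB.2 b hb h)) (fun h => hdB r hrp b' hb' (hyB.2 b' hb'B h))
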